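/- Let (X, A_X) be a finite network with n nodes and let t ≥ n be an integer. Then the semi-reciprocal ultrametric with parameter t coincides with the nonreciprocal ultrametric: u^{SR(t)}(x,x') = u^{NR}(x,x') = max(ũ*(x,x'), ũ*(x',x)) for all x, x' ∈ X. -/

import Mathlib

noncomputable section

/-- Cost of a chain (a finite ordered list of nodes): the maximum dissimilarity
encountered over consecutive pairs (0 for chains with fewer than two nodes). -/
def chainCost {X : Type*} (A : X → X → ℝ) : List X → ℝ
  | [] => 0
  | [_] => 0
  | a :: b :: rest => max (A a b) (chainCost A (b :: rest))

/-- The set of costs of chains from `x` to `x'`. -/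
def chainCosts {X : Type*} (A : X → X → ℝ) (x x' : X) : Set ℝ :=
  { c | ∃ l : List X, l.head? = some x ∧ l.getLast? = some x' ∧ chainCost A l = c }

/-- Directed minimum chain cost ũ*(x,x'). -/
def minChainCost {X : Type*} (A : X → X → ℝ) (x x' : X) : ℝ :=
  sInf (chainCosts A x x')

/-- The reciprocal ultrametric u^R. -/
def uR {X : Type*} (A : X → X → ℝ) (x x' : X) : ℝ :=
  minChainCost (fun a b => max (A a b) (A b a)) x x'

/-- The nonreciprocal ultrametric u^NR. -/
def uNR {X : Type*} (A : X → X → ℝ) (x x' : X) : ℝ :=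
  max (minChainCost A x x') (minChainCost A x' x)

/-- The set of costs of chains from `x` to `x'` having at most `t` nodes. -/
def boundedChainCosts {X : Type*} (A : X → X → ℝ) (t : ℕ) (x x' : X) : Set ℝ :=
  { c | ∃ l : List X, l.head? = some x ∧ l.getLast? = some x' ∧ l.length ≤ t ∧
      chainCost A l = c }

/-- A^{SR(t)}(x,x'): minimum cost over chains from `x` to `x'` with at most `t` nodes. -/
def ASR {X : Type*} (A : X → X → ℝ) (t : ℕ) (x x' : X) : ℝ :=
  sInf (boundedChainCosts A t x x')

/-- The semi-reciprocal ultrametric u^{SR(t)}. -/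
def uSR {X : Type*} (A : X → X → ℝ) (t : ℕ) (x x' : X) : ℝ :=
  minChainCost (fun a b => max (ASR A t a b) (ASR A t b a)) x x'

theorem chainCost_nonneg {X : Type*} (A : X → X → ℝ) : ∀ l : List X, 0 ≤ chainCost A l
  | [] => le_rfl
  | [_] => le_rfl
  | _ :: b :: r => le_max_of_le_right (chainCost_nonneg A (b :: r))

theorem chainCost_le_cons {X : Type*} (A : X → X → ℝ) (a : X) :
    ∀ l : List X, chainCost A l ≤ chainCost A (a :: l)
  | [] => le_rfl
  | _ :: _ => le_max_right _ _

theorem chainCost_le_append_left {X : Type*} (A : X → X → ℝ) (r : List X) :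
    ∀ s : List X, chainCost A r ≤ chainCost A (s ++ r)
  | [] => le_rfl
  | a :: s => (chainCost_le_append_left A r s).trans (chainCost_le_cons A a (s ++ r))

/-- The cost of a concatenation of two chains sharing the node `y`. -/
theorem chainCost_append_le {X : Type*} (A : X → X → ℝ) (y : X) (r : List X) :
    ∀ l : List X, l.getLast? = some y →
      chainCost A (l ++ r) ≤ max (chainCost A l) (chainCost A (y :: r))
  | [], h => by simp at h
  | [a], h => by
      obtain rfl : a = y := by simpa using h
      exact le_max_right _ _
  | a :: b :: s, h => by
      have ih := chainCost_append_le A y r (b :: s) (by simpa using h)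
      change max (A a b) (chainCost A (b :: s ++ r)) ≤
        max (max (A a b) (chainCost A (b :: s))) (chainCost A (y :: r))
      rw [max_assoc]
      exact max_le_max_left _ ih

/-- Removing loops from a chain does not increase its cost. -/
theorem exists_nodup_chainCost_le {X : Type*} (A : X → X → ℝ) :
    ∀ l : List X, ∃ l' : List X, l'.Nodup ∧ l'.head? = l.head? ∧ l'.getLast? = l.getLast? ∧
      chainCost A l' ≤ chainCost A l
  | [] => ⟨[], by simp⟩
  | [a] => ⟨[a], by simp⟩
  | a :: b :: s => by
      obtain ⟨l', hnd, hhead, hlast, hcost⟩ := exists_nodup_chainCost_le A (b :: s)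
      by_cases ha : a ∈ l'
      · obtain ⟨p, r, rfl⟩ := List.append_of_mem ha
        refine ⟨a :: r, hnd.of_append_right, rfl, ?_, ?_⟩
        · simpa [List.getLast?_cons] using hlast
        · exact (chainCost_le_append_left A _ p).trans (hcost.trans (le_max_right _ _))
      · cases l' with
        | nil => simp at hhead
        | cons c r =>
          obtain rfl : c = b := by simpa using hhead
          exact ⟨a :: c :: r, List.nodup_cons.2 ⟨ha, hnd⟩, rfl, by simpa using hlast,
            max_le_max_left _ hcost⟩

theorem bddBelow_chainCosts {X : Type*} (A : X → X → ℝ) (x x' : X) :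
    BddBelow (chainCosts A x x') :=
  ⟨0, by rintro _ ⟨l, -, -, rfl⟩; exact chainCost_nonneg A l⟩

theorem chainCosts_nonempty {X : Type*} (A : X → X → ℝ) (x x' : X) :
    (chainCosts A x x').Nonempty :=
  ⟨_, [x, x'], rfl, rfl, rfl⟩

theorem minChainCost_le_chainCost {X : Type*} (A : X → X → ℝ) {x x' : X} {l : List X}
    (hhead : l.head? = some x) (hlast : l.getLast? = some x') :
    minChainCost A x x' ≤ chainCost A l :=
  csInf_le (bddBelow_chainCosts A x x') ⟨l, hhead, hlast, rfl⟩

theorem minChainCost_nonneg {X : Type*} (A : X → X → ℝ) (x x' : X) :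
    0 ≤ minChainCost A x x' :=
  le_csInf (chainCosts_nonempty A x x')
    (by rintro _ ⟨l, -, -, rfl⟩; exact chainCost_nonneg A l)

theorem minChainCost_self {X : Type*} (A : X → X → ℝ) (x : X) : minChainCost A x x = 0 :=
  le_antisymm (minChainCost_le_chainCost A (l := [x]) rfl rfl) (minChainCost_nonneg A x x)

/-- The directed minimum chain cost satisfies the strong triangle inequality. -/
theorem minChainCost_le_max {X : Type*} (A : X → X → ℝ) (x y z : X) :
    minChainCost A x z ≤ max (minChainCost A x y) (minChainCost A y z) := by
  refine le_of_forall_gt fun c hc => ?_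
  obtain ⟨hxy, hyz⟩ := max_lt_iff.1 hc
  obtain ⟨_, ⟨l, hl, hl', rfl⟩, hlc⟩ := exists_lt_of_csInf_lt (chainCosts_nonempty A x y) hxy
  obtain ⟨_, ⟨k, hk, hk', rfl⟩, hkc⟩ := exists_lt_of_csInf_lt (chainCosts_nonempty A y z) hyz
  cases k with
  | nil => simp at hk
  | cons w r =>
    obtain rfl : w = y := by simpa using hk
    refine (minChainCost_le_chainCost A (l := l ++ r) ?_ ?_).trans_lt
      ((chainCost_append_le A w r l hl').trans_lt (max_lt hlc hkc))
    · simp [List.head?_append, hl]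
    · rw [List.getLast?_append, hl']
      simpa [List.getLast?_cons, Option.getD_eq_iff] using hk'

/-- With at least as many allowed nodes as there are points, bounding chains is no restriction. -/
theorem ASR_eq_minChainCost {X : Type*} [Fintype X] (A : X → X → ℝ) {t : ℕ}
    (ht : Fintype.card X ≤ t) (x x' : X) : ASR A t x x' = minChainCost A x x' := by
  have hshort : ∀ c ∈ chainCosts A x x', ∃ d ∈ boundedChainCosts A t x x', d ≤ c := by
    rintro _ ⟨l, hl, hl', rfl⟩
    obtain ⟨l', hnd, hhead, hlast, hcost⟩ := exists_nodup_chainCost_le A l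
    exact ⟨_, ⟨l', hhead.trans hl, hlast.trans hl', hnd.length_le_card.trans ht, rfl⟩, hcost⟩
  have hsub : boundedChainCosts A t x x' ⊆ chainCosts A x x' := by
    rintro _ ⟨l, hl, hl', -, rfl⟩
    exact ⟨l, hl, hl', rfl⟩
  have hne : (boundedChainCosts A t x x').Nonempty := by
    obtain ⟨c, hc⟩ := chainCosts_nonempty A x x'
    obtain ⟨d, hd, -⟩ := hshort c hc
    exact ⟨d, hd⟩
  have hbdd := bddBelow_chainCosts A x x'
  refine le_antisymm (le_csInf (chainCosts_nonempty A x x') fun c hc => ?_)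
    (csInf_le_csInf hbdd hne hsub)
  obtain ⟨d, hd, hdc⟩ := hshort c hc
  exact (csInf_le (hbdd.mono hsub) hd).trans hdc

/-- The strong triangle inequality along a chain. -/
theorem le_chainCost_of_ultrametric {X : Type*} {B : X → X → ℝ} (hself : ∀ x, B x x = 0)
    (htri : ∀ x y z, B x z ≤ max (B x y) (B y z)) :
    ∀ (l : List X) {x x' : X}, l.head? = some x → l.getLast? = some x' → B x x' ≤ chainCost B l
  | [], _, _, h, _ => by simp at h
  | [a], x, x', h, h' => by
      obtain rfl : a = x := by simpa using h
      obtain rfl : a = x' := by simpa using h'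
      exact (hself a).le
  | a :: b :: s, x, x', h, h' => by
      obtain rfl : a = x := by simpa using h
      exact (htri a b x').trans (max_le_max_left _
        (le_chainCost_of_ultrametric hself htri (b :: s) rfl (by simpa using h')))

theorem minChainCost_eq_self_of_ultrametric {X : Type*} {B : X → X → ℝ}
    (hnonneg : ∀ x x', 0 ≤ B x x') (hself : ∀ x, B x x = 0)
    (htri : ∀ x y z, B x z ≤ max (B x y) (B y z)) (x x' : X) :
    minChainCost B x x' = B x x' := by
  refine le_antisymm ?_ (le_csInf (chainCosts_nonempty B x x') ?_)
  · exact (minChainCost_le_chainCost B (l := [x, x']) rfl rfl).trans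
      (max_le le_rfl (hnonneg x x'))
  · rintro _ ⟨l, hl, hl', rfl⟩
    exact le_chainCost_of_ultrametric hself htri l hl hl'

theorem uNR_le_max {X : Type*} (A : X → X → ℝ) (x y z : X) :
    uNR A x z ≤ max (uNR A x y) (uNR A y z) :=
  max_le
    ((minChainCost_le_max A x y z).trans (max_le_max (le_max_left _ _) (le_max_left _ _)))
    ((minChainCost_le_max A z y x).trans
      ((max_comm _ _).trans_le (max_le_max (le_max_right _ _) (le_max_right _ _))))

/-- in a finite network with n nodes, the semi-reciprocal
ultrametric with parameter t ≥ n coincides with the nonreciprocal ultrametric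
u^{NR}(x,x') = max(ũ*(x,x'), ũ*(x',x)). -/
theorem semireciprocal_large_t_eq_nonreciprocal {X : Type*} [Fintype X]
    (A : X → X → ℝ)
    (hnonneg : ∀ x x' : X, 0 ≤ A x x')
    (hid : ∀ x x' : X, A x x' = 0 ↔ x = x')
    (t : ℕ) (ht : Fintype.card X ≤ t) :
    ∀ x x' : X,
      uSR A t x x' = uNR A x x' ∧
      uNR A x x' = max (minChainCost A x x') (minChainCost A x' x) := by
  intro x x'
  refine ⟨?_, rfl⟩
  have hB : (fun a b => max (ASR A t a b) (ASR A t b a)) = uNR A := by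
    funext a b
    simp only [ASR_eq_minChainCost A ht, uNR]
  rw [uSR, hB]
  exact minChainCost_eq_self_of_ultrametric
    (fun a b => le_max_of_le_left (minChainCost_nonneg A a b))
    (fun a => by simp [minChainCost_self]) (uNR_le_max A) x x'
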